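/- arXiv:math/9701211 — 2 statements merged into one kernel-verified Lean document; each statement's English description precedes it below -/
import Mathlib

section
/- There is a unique group homomorphism σ : G(p,q,r) → G(p,q,r) with σ(h) = h⁻¹, σ(x) = x⁻¹, σ(y) = x·y⁻¹·x⁻¹, and σ(z) = x·y·z⁻¹·y⁻¹·x⁻¹; moreover σ∘σ = id, so σ is an automorphism of G(p,q,r) of order at most 2. -/
open Quaternion

/-- `Sp(1)`: the multiplicative group of unit quaternions, identified with `SU(2)`. -/
noncomputable abbrev Sp1 : Type := Metric.sphere (0 : ℍ[ℝ]) 1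

/-- Relators of the presentation
`⟨x, y, z, h | h central, x^p = h^{-b₁}, y^q = h^{-b₂}, z^r = h^{-b₃}, xyz = h^{-b}⟩`,
with the generators `x, y, z, h` encoded as `0, 1, 2, 3 : Fin 4`. -/
def brieskornRels (p q r : ℕ) (b b₁ b₂ b₃ : ℤ) : Set (FreeGroup (Fin 4)) :=
  { (FreeGroup.of 3) * (FreeGroup.of 0) * (FreeGroup.of 3)⁻¹ * (FreeGroup.of 0)⁻¹,
    (FreeGroup.of 3) * (FreeGroup.of 1) * (FreeGroup.of 3)⁻¹ * (FreeGroup.of 1)⁻¹,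
    (FreeGroup.of 3) * (FreeGroup.of 2) * (FreeGroup.of 3)⁻¹ * (FreeGroup.of 2)⁻¹,
    (FreeGroup.of 0) ^ p * (FreeGroup.of 3) ^ b₁,
    (FreeGroup.of 1) ^ q * (FreeGroup.of 3) ^ b₂,
    (FreeGroup.of 2) ^ r * (FreeGroup.of 3) ^ b₃,
    (FreeGroup.of 0) * (FreeGroup.of 1) * (FreeGroup.of 2) * (FreeGroup.of 3) ^ b }

/-- The group `G(p,q,r)`, i.e. the fundamental group of the Brieskorn homology
sphere `Σ(p,q,r)`, given by the presentation above. -/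
def BrieskornGroup (p q r : ℕ) (b b₁ b₂ b₃ : ℤ) : Type :=
  PresentedGroup (brieskornRels p q r b b₁ b₂ b₃)

instance (p q r : ℕ) (b b₁ b₂ b₃ : ℤ) : Group (BrieskornGroup p q r b b₁ b₂ b₃) := by
  unfold BrieskornGroup; infer_instance

/-- The generator `x` of `G(p,q,r)`. -/
def xG {p q r : ℕ} {b b₁ b₂ b₃ : ℤ} : BrieskornGroup p q r b b₁ b₂ b₃ := PresentedGroup.of 0
/-- The generator `y` of `G(p,q,r)`. -/
def yG {p q r : ℕ} {b b₁ b₂ b₃ : ℤ} : BrieskornGroup p q r b b₁ b₂ b₃ := PresentedGroup.of 1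
/-- The generator `z` of `G(p,q,r)`. -/
def zG {p q r : ℕ} {b b₁ b₂ b₃ : ℤ} : BrieskornGroup p q r b b₁ b₂ b₃ := PresentedGroup.of 2
/-- The central generator `h` of `G(p,q,r)`. -/
def hG {p q r : ℕ} {b b₁ b₂ b₃ : ℤ} : BrieskornGroup p q r b b₁ b₂ b₃ := PresentedGroup.of 3

/-- The defining values of the involution `σ` on the generators of `G(p,q,r)`. -/
def SigmaSpec {p q r : ℕ} {b b₁ b₂ b₃ : ℤ}
    (σ : BrieskornGroup p q r b b₁ b₂ b₃ →* BrieskornGroup p q r b b₁ b₂ b₃) : Prop :=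
  σ hG = hG⁻¹ ∧ σ xG = xG⁻¹ ∧ σ yG = xG * yG⁻¹ * xG⁻¹ ∧
    σ zG = xG * yG * zG⁻¹ * yG⁻¹ * xG⁻¹

namespace BrieskornGroup

variable {p q r : ℕ} {b b₁ b₂ b₃ : ℤ}

/-- Four elements of a group satisfying the defining relations of `G(p,q,r)` determine a
homomorphism out of `G(p,q,r)`. -/
theorem exists_hom {H : Type*} [Group H] {x y z h : H}
    (hx : Commute h x) (hy : Commute h y) (hz : Commute h z)
    (hxp : x ^ p * h ^ b₁ = 1) (hyq : y ^ q * h ^ b₂ = 1) (hzr : z ^ r * h ^ b₃ = 1)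
    (hxyz : x * y * z * h ^ b = 1) :
    ∃ f : BrieskornGroup p q r b b₁ b₂ b₃ →* H,
      f xG = x ∧ f yG = y ∧ f zG = z ∧ f hG = h := by
  have hrel : ∀ w ∈ brieskornRels p q r b b₁ b₂ b₃, FreeGroup.lift ![x, y, z, h] w = 1 := by
    rintro w (rfl | rfl | rfl | rfl | rfl | rfl | rfl) <;>
      simp [hx.eq, hy.eq, hz.eq, hxp, hyq, hzr, hxyz]
  let f : PresentedGroup (brieskornRels p q r b b₁ b₂ b₃) →* H := PresentedGroup.toGroup hrel
  have hf (i : Fin 4) : f (PresentedGroup.of i) = ![x, y, z, h] i :=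
    PresentedGroup.toGroup.of hrel
  exact ⟨f, hf 0, hf 1, hf 2, hf 3⟩

/-- Homomorphisms out of `G(p,q,r)` agreeing on the generators are equal. -/
theorem hom_ext {H : Type*} [Group H] {f g : BrieskornGroup p q r b b₁ b₂ b₃ →* H}
    (hx : f xG = g xG) (hy : f yG = g yG) (hz : f zG = g zG) (hh : f hG = g hG) : f = g :=
  PresentedGroup.ext (rels := brieskornRels p q r b b₁ b₂ b₃) fun i => by
    fin_cases i
    exacts [hx, hy, hz, hh]

/-- The generators of `G(p,q,r)` satisfy its defining relations. -/
theorem generator_relations :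
    Commute (hG : BrieskornGroup p q r b b₁ b₂ b₃) xG ∧
    Commute (hG : BrieskornGroup p q r b b₁ b₂ b₃) yG ∧
    Commute (hG : BrieskornGroup p q r b b₁ b₂ b₃) zG ∧
    (xG : BrieskornGroup p q r b b₁ b₂ b₃) ^ p * hG ^ b₁ = 1 ∧
    (yG : BrieskornGroup p q r b b₁ b₂ b₃) ^ q * hG ^ b₂ = 1 ∧
    (zG : BrieskornGroup p q r b b₁ b₂ b₃) ^ r * hG ^ b₃ = 1 ∧
    (xG : BrieskornGroup p q r b b₁ b₂ b₃) * yG * zG * hG ^ b = 1 := by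
  have hrel (w) (hw : w ∈ brieskornRels p q r b b₁ b₂ b₃) :
      PresentedGroup.mk (brieskornRels p q r b b₁ b₂ b₃) w = 1 :=
    PresentedGroup.one_of_mem hw
  have hcomm {a c : BrieskornGroup p q r b b₁ b₂ b₃} (hac : a * c * a⁻¹ * c⁻¹ = 1) :
      Commute a c :=
    mul_inv_eq_iff_eq_mul.mp (mul_inv_eq_one.mp hac)
  refine ⟨hcomm (hrel _ ?_), hcomm (hrel _ ?_), hcomm (hrel _ ?_), hrel _ ?_, hrel _ ?_,
    hrel _ ?_, hrel _ ?_⟩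
  · exact .inl rfl
  · exact .inr (.inl rfl)
  · exact .inr (.inr (.inl rfl))
  · exact .inr (.inr (.inr (.inl rfl)))
  · exact .inr (.inr (.inr (.inr (.inl rfl))))
  · exact .inr (.inr (.inr (.inr (.inr (.inl rfl)))))
  · exact .inr (.inr (.inr (.inr (.inr (.inr rfl)))))

/-- If `a ^ n` and `h ^ m` are mutually inverse and `h` commutes with `g`, the same
holds for `h⁻¹` and the conjugate of `a⁻¹` by `g`. -/
theorem conj_inv_pow_mul_inv_zpow {H : Type*} [Group H] {a g h : H} {n : ℕ} {m : ℤ}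
    (hg : Commute h g) (han : a ^ n * h ^ m = 1) :
    (g * a⁻¹ * g⁻¹) ^ n * h⁻¹ ^ m = 1 := by
  rw [conj_pow, inv_pow, eq_inv_of_mul_eq_one_left han, inv_inv, (hg.zpow_left m).eq.symm,
    inv_zpow]
  group

/-- There is an endomorphism of `G(p,q,r)` with the prescribed values on generators. -/
theorem exists_sigmaSpec : ∃ σ : BrieskornGroup p q r b b₁ b₂ b₃ →* _, SigmaSpec σ := by
  obtain ⟨hx, hy, hz, hxp, hyq, hzr, hxyz⟩ :=
    generator_relations (p := p) (q := q) (r := r) (b := b) (b₁ := b₁) (b₂ := b₂) (b₃ := b₃)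
  have hprod : (xG⁻¹ * (xG * yG⁻¹ * xG⁻¹) * (xG * yG * zG⁻¹ * (xG * yG)⁻¹) * hG⁻¹ ^ b :
      BrieskornGroup p q r b b₁ b₂ b₃) = 1 := by
    have hinv := eq_inv_of_mul_eq_one_left hxyz
    calc _ = (xG * yG * zG)⁻¹ * hG⁻¹ ^ b := by group
      _ = 1 := by rw [hinv, inv_inv, inv_zpow, mul_inv_cancel]
  obtain ⟨σ, hσx, hσy, hσz, hσh⟩ := exists_hom
    hx.inv_inv ((hx.mul_right hy.inv_right).mul_right hx.inv_right).inv_left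
    (((hx.mul_right hy).mul_right hz.inv_right).mul_right (hx.mul_right hy).inv_right).inv_left
    (by simpa using conj_inv_pow_mul_inv_zpow (Commute.one_right _) hxp)
    (conj_inv_pow_mul_inv_zpow hx hyq)
    (conj_inv_pow_mul_inv_zpow (hx.mul_right hy) hzr) hprod
  exact ⟨σ, hσh, hσx, hσy, by rw [hσz, mul_inv_rev, ← mul_assoc]⟩

end BrieskornGroup

/-- There is a unique homomorphism `σ : G(p,q,r) → G(p,q,r)` with
`σ(h) = h⁻¹`, `σ(x) = x⁻¹`, `σ(y) = xy⁻¹x⁻¹`, `σ(z) = xyz⁻¹y⁻¹x⁻¹`; moreover any such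
`σ` satisfies `σ ∘ σ = id`, so `σ` is an automorphism of order at most 2. -/
theorem stmt_3 (p q r : ℕ) (hp : 2 ≤ p) (hq : 2 ≤ q) (hr : 2 ≤ r)
    (hpq : Nat.Coprime p q) (hqr : Nat.Coprime q r) (hpr : Nat.Coprime p r)
    (b b₁ b₂ b₃ : ℤ)
    (hsum : b₁ * q * r + b₂ * p * r + b₃ * p * q + b * p * q * r = 1) :
    (∃! σ : BrieskornGroup p q r b b₁ b₂ b₃ →* BrieskornGroup p q r b b₁ b₂ b₃,
      SigmaSpec σ) ∧
    ∀ σ : BrieskornGroup p q r b b₁ b₂ b₃ →* BrieskornGroup p q r b b₁ b₂ b₃,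
      SigmaSpec σ → σ.comp σ = MonoidHom.id _ := by
  refine ⟨?_, fun σ hσ => ?_⟩
  · obtain ⟨σ, hσ⟩ := BrieskornGroup.exists_sigmaSpec
      (p := p) (q := q) (r := r) (b := b) (b₁ := b₁) (b₂ := b₂) (b₃ := b₃)
    refine ⟨σ, hσ, fun τ hτ => ?_⟩
    obtain ⟨hh, hx, hy, hz⟩ := hσ
    obtain ⟨hh', hx', hy', hz'⟩ := hτ
    exact BrieskornGroup.hom_ext (hx'.trans hx.symm) (hy'.trans hy.symm) (hz'.trans hz.symm)
      (hh'.trans hh.symm)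
  · obtain ⟨hh, hx, hy, hz⟩ := hσ
    apply BrieskornGroup.hom_ext <;>
      simp [hh, hx, hy, hz, mul_assoc]
end

section
/- Let α : G(p,q,r) → Sp(1) be an irreducible homomorphism. Then α(h) = 1 or α(h) = -1, none of α(x), α(y), α(z) equals ±1, and there exist integers ℓ₁, ℓ₂, ℓ₃ with 0 < ℓ₁ < p, 0 < ℓ₂ < q, 0 < ℓ₃ < r such that Re α(x) = cos(πℓ₁/p), Re α(y) = cos(πℓ₂/q), and Re(α(x)·α(y)) = cos(πℓ₃/r), where ℓ₁ is even if and only if α(h)^{b₁} = 1, ℓ₂ is even if and only if α(h)^{b₂} = 1, and ℓ₃ is even if and only if α(h)^{b₃ - rb} = 1. -/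
open Quaternion

/-- A homomorphism to `Sp(1)` is irreducible if its image is nonabelian. -/
def IsIrrep {Γ : Type*} [Group Γ] (α : Γ →* Sp1) : Prop :=
  ∃ s t : Γ, α s * α t ≠ α t * α s

theorem Quaternion.commute_of_commute_of_im_ne_zero {a b c : ℍ[ℝ]} (hc : c.im ≠ 0)
    (ha : Commute a c) (hb : Commute b c) : Commute a b := by
  have ha' := ha.eq
  have hb' := hb.eq
  rw [Ne, Quaternion.ext_iff] at hc
  rw [Quaternion.ext_iff] at ha' hb'
  simp only [re_mul, imI_mul, imJ_mul, imK_mul] at ha' hb'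
  simp only [re_im, imI_im, imJ_im, imK_im, re_zero, imI_zero, imJ_zero, imK_zero,
    true_and] at hc
  obtain ⟨-, a1, a2, a3⟩ := ha'
  obtain ⟨-, b1, b2, b3⟩ := hb'
  change a * b = b * a
  ext <;> simp only [re_mul, imI_mul, imJ_mul, imK_mul]
  · ring
  all_goals
    by_cases h1 : c.imI = 0
    · by_cases h2 : c.imJ = 0
      · have h3 : c.imK ≠ 0 := fun h3 => hc ⟨h1, h2, h3⟩
        apply mul_left_cancel₀ h3
        grind
      · apply mul_left_cancel₀ h2
        grind
    · apply mul_left_cancel₀ h1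
      grind

theorem Quaternion.pow_eq_cos_add_sin_smul {g u : ℍ[ℝ]} {θ : ℝ} (hu : u * u = -1)
    (hg : g = Real.cos θ • 1 + Real.sin θ • u) (n : ℕ) :
    g ^ n = Real.cos (n * θ) • 1 + Real.sin (n * θ) • u := by
  induction n with
  | zero => simp
  | succ n ih =>
    have h : ((n + 1 : ℕ) : ℝ) * θ = n * θ + θ := by push_cast; ring
    rw [pow_succ, ih, h, Real.cos_add, Real.sin_add, hg]
    simp only [add_mul, mul_add, smul_mul_smul_comm, hu, mul_one, one_mul]
    module

namespace Sp1

theorem eq_one_or_eq_neg_one_iff {g : Sp1} : (g = 1 ∨ g = -1) ↔ g ^ 2 = 1 := by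
  simp only [Subtype.ext_iff, Metric.unitSphere.coe_one, Metric.unitSphere.coe_pow, coe_neg_sphere,
    sq_eq_one_iff]

theorem sum_sq_eq_one (g : Sp1) :
    (g : ℍ[ℝ]).re ^ 2 + (g : ℍ[ℝ]).imI ^ 2 + (g : ℍ[ℝ]).imJ ^ 2 + (g : ℍ[ℝ]).imK ^ 2 = 1 := by
  rw [← normSq_def', normSq_eq_norm_mul_self, norm_eq_of_mem_sphere g, one_mul]

theorem eq_one_or_eq_neg_one_of_re_sq {g : Sp1} (h : (g : ℍ[ℝ]).re ^ 2 = 1) :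
    g = 1 ∨ g = -1 := by
  have hs := sum_sq_eq_one g
  have h1 : (g : ℍ[ℝ]).imI = 0 := by nlinarith
  have h2 : (g : ℍ[ℝ]).imJ = 0 := by nlinarith
  have h3 : (g : ℍ[ℝ]).imK = 0 := by nlinarith
  refine (sq_eq_one_iff.mp h).imp ?_ ?_ <;> intro h0 <;> apply Subtype.ext <;>
    ext <;> simp [h0, h1, h2, h3]

theorem eq_one_or_eq_neg_one_of_im_eq_zero {g : Sp1} (h : (g : ℍ[ℝ]).im = 0) :
    g = 1 ∨ g = -1 := by
  have hs := sum_sq_eq_one g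
  have h' := Quaternion.ext_iff.mp h
  simp only [re_im, imI_im, imJ_im, imK_im, re_zero, imI_zero, imJ_zero, imK_zero,
    true_and] at h'
  rw [h'.1, h'.2.1, h'.2.2] at hs
  exact eq_one_or_eq_neg_one_of_re_sq (by linarith)

theorem commute_of_eq_one_or_eq_neg_one {g : Sp1} (h : g = 1 ∨ g = -1) (k : Sp1) :
    Commute g k := by
  rcases h with rfl | rfl
  · exact Commute.one_left k
  · exact Commute.neg_one_left k

set_option synthInstance.maxHeartbeats 200000 in
/-- A noncentral `n`-th root of `±1` in `Sp(1)` has real part `cos (πℓ/n)` with `0 < ℓ < n`. -/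
theorem exists_re_eq_cos {g : Sp1} {n : ℕ} (hn : 0 < n) (hg : ¬(g = 1 ∨ g = -1))
    (h : g ^ n = 1 ∨ g ^ n = -1) :
    ∃ l : ℤ, 0 < l ∧ l < (n : ℤ) ∧ (g : ℍ[ℝ]).re = Real.cos (Real.pi * l / n) ∧
      (Even l ↔ g ^ n = 1) := by
  have hs := sum_sq_eq_one g
  have hre : (g : ℍ[ℝ]).re ^ 2 < 1 :=
    lt_of_le_of_ne (by nlinarith) fun h => hg (eq_one_or_eq_neg_one_of_re_sq h)
  have hre1 : (g : ℍ[ℝ]).re < 1 := by nlinarith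
  have hre2 : -1 < (g : ℍ[ℝ]).re := by nlinarith
  obtain ⟨θ, hθ⟩ : ∃ θ, θ = Real.arccos (g : ℍ[ℝ]).re := ⟨_, rfl⟩
  have hcos : Real.cos θ = (g : ℍ[ℝ]).re := by rw [hθ, Real.cos_arccos hre2.le hre1.le]
  have hpos : 0 < θ := by rw [hθ]; exact Real.arccos_pos.mpr hre1
  have hlt : θ < Real.pi := by
    refine lt_of_le_of_ne (hθ ▸ Real.arccos_le_pi _) fun h => ?_
    rw [h, Real.cos_pi] at hcos
    linarith
  have hsin : Real.sin θ ≠ 0 := (Real.sin_pos_of_pos_of_lt_pi hpos hlt).ne'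
  have him : (g : ℍ[ℝ]).imI ^ 2 + (g : ℍ[ℝ]).imJ ^ 2 + (g : ℍ[ℝ]).imK ^ 2 = Real.sin θ ^ 2 := by
    rw [Real.sin_sq, hcos]; linarith
  obtain ⟨u, hu⟩ : ∃ u : ℍ[ℝ], u = (Real.sin θ)⁻¹ • (g : ℍ[ℝ]).im := ⟨_, rfl⟩
  have hure : u.re = 0 := by simp [hu]
  have huu : u * u = -1 := by
    rw [hu, smul_mul_smul_comm]
    ext
    · simp only [re_smul, re_mul, re_im, imI_im, imJ_im, imK_im, smul_eq_mul, re_neg, re_one]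
      field_simp
      linarith
    all_goals simp; try (right; ring)
  have hgu : (g : ℍ[ℝ]) = Real.cos θ • 1 + Real.sin θ • u := by
    rw [hu, smul_inv_smul₀ hsin, hcos]
    ext <;> simp
  have hpow := Quaternion.pow_eq_cos_add_sin_smul huu hgu n
  have hc : (g ^ n = 1 ∧ Real.cos (n * θ) = 1) ∨ (g ^ n ≠ 1 ∧ Real.cos (n * θ) = -1) := by
    have hc := congrArg (fun a : ℍ[ℝ] => a.re) hpow
    simp only [re_add, re_smul, hure, re_one, smul_eq_mul, mul_one, mul_zero, add_zero] at hc
    rw [← hc, ← Metric.unitSphere.coe_pow]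
    rcases h with h | h
    · simp [h]
    · refine Or.inr ⟨fun h' => ?_, by simp [h]⟩
      have := congrArg (fun a : Sp1 => (a : ℍ[ℝ]).re) (h.symm.trans h')
      norm_num at this
  have hsn : Real.sin (n * θ) = 0 := by
    have := Real.sin_sq_add_cos_sq (n * θ)
    rcases hc with ⟨-, hc⟩ | ⟨-, hc⟩ <;> rw [hc] at this <;> nlinarith
  obtain ⟨l, hl⟩ := Real.sin_eq_zero_iff.mp hsn
  have hn' : (0 : ℝ) < n := by exact_mod_cast hn
  have hπ := Real.pi_pos
  refine ⟨l, ?_, ?_, ?_, ?_⟩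
  · have : (0 : ℝ) < l := by
      have : 0 < (l : ℝ) * Real.pi := by rw [hl]; positivity
      exact pos_of_mul_pos_left this hπ.le
    exact_mod_cast this
  · have : (l : ℝ) < n := by
      have : (l : ℝ) * Real.pi < n * Real.pi := by rw [hl]; gcongr
      exact lt_of_mul_lt_mul_right this hπ.le
    exact_mod_cast this
  · rw [← hcos]
    congr 1
    field_simp
    linarith
  · rw [← hl, Real.cos_int_mul_pi] at hc
    rcases Int.even_or_odd l with hp | hp
    · rw [hp.neg_one_zpow] at hc
      rcases hc with hc | hc
      · exact iff_of_true hp hc.1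
      · norm_num at hc
    · rw [hp.neg_one_zpow] at hc
      rcases hc with hc | hc
      · norm_num at hc
      · exact iff_of_false (Int.not_even_iff_odd.mpr hp) hc.1

end Sp1

namespace BrieskornGroup

variable {p q r : ℕ} {b b₁ b₂ b₃ : ℤ}

theorem mk_eq_one {w : FreeGroup (Fin 4)} (hw : w ∈ brieskornRels p q r b b₁ b₂ b₃) :
    PresentedGroup.mk (brieskornRels p q r b b₁ b₂ b₃) w = 1 :=
  PresentedGroup.one_of_mem hw

theorem commute_hG_xG : Commute (hG : BrieskornGroup p q r b b₁ b₂ b₃) xG := by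
  have h := mk_eq_one (p := p) (q := q) (r := r) (b := b) (b₁ := b₁) (b₂ := b₂) (b₃ := b₃)
    (w := .of 3 * .of 0 * (.of 3)⁻¹ * (.of 0)⁻¹) (by simp [brieskornRels])
  simp only [map_mul, map_inv] at h
  exact mul_inv_eq_iff_eq_mul.mp (mul_inv_eq_one.mp h)

theorem commute_hG_yG : Commute (hG : BrieskornGroup p q r b b₁ b₂ b₃) yG := by
  have h := mk_eq_one (p := p) (q := q) (r := r) (b := b) (b₁ := b₁) (b₂ := b₂) (b₃ := b₃)
    (w := .of 3 * .of 1 * (.of 3)⁻¹ * (.of 1)⁻¹) (by simp [brieskornRels])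
  simp only [map_mul, map_inv] at h
  exact mul_inv_eq_iff_eq_mul.mp (mul_inv_eq_one.mp h)

theorem xG_pow : (xG : BrieskornGroup p q r b b₁ b₂ b₃) ^ p = (hG ^ b₁)⁻¹ := by
  have h := mk_eq_one (p := p) (q := q) (r := r) (b := b) (b₁ := b₁) (b₂ := b₂) (b₃ := b₃)
    (w := .of 0 ^ p * .of 3 ^ b₁) (by simp [brieskornRels])
  simp only [map_mul, map_pow, map_zpow] at h
  exact eq_inv_of_mul_eq_one_left h

theorem yG_pow : (yG : BrieskornGroup p q r b b₁ b₂ b₃) ^ q = (hG ^ b₂)⁻¹ := by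
  have h := mk_eq_one (p := p) (q := q) (r := r) (b := b) (b₁ := b₁) (b₂ := b₂) (b₃ := b₃)
    (w := .of 1 ^ q * .of 3 ^ b₂) (by simp [brieskornRels])
  simp only [map_mul, map_pow, map_zpow] at h
  exact eq_inv_of_mul_eq_one_left h

theorem zG_pow : (zG : BrieskornGroup p q r b b₁ b₂ b₃) ^ r = (hG ^ b₃)⁻¹ := by
  have h := mk_eq_one (p := p) (q := q) (r := r) (b := b) (b₁ := b₁) (b₂ := b₂) (b₃ := b₃)
    (w := .of 2 ^ r * .of 3 ^ b₃) (by simp [brieskornRels])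
  simp only [map_mul, map_pow, map_zpow] at h
  exact eq_inv_of_mul_eq_one_left h

theorem xG_mul_yG_mul_zG :
    (xG : BrieskornGroup p q r b b₁ b₂ b₃) * yG * zG = (hG ^ b)⁻¹ := by
  have h := mk_eq_one (p := p) (q := q) (r := r) (b := b) (b₁ := b₁) (b₂ := b₂) (b₃ := b₃)
    (w := .of 0 * .of 1 * .of 2 * .of 3 ^ b) (by simp [brieskornRels])
  simp only [map_mul, map_zpow] at h
  exact eq_inv_of_mul_eq_one_left h

theorem closure_eq_top :
    Subgroup.closure ({xG, yG, zG, hG} : Set (BrieskornGroup p q r b b₁ b₂ b₃)) = ⊤ := by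
  have h := PresentedGroup.closure_range_of (brieskornRels p q r b b₁ b₂ b₃)
  refine top_le_iff.mp (h.ge.trans (Subgroup.closure_mono ?_))
  rintro _ ⟨i, rfl⟩
  fin_cases i
  · exact .inl rfl
  · exact .inr (.inl rfl)
  · exact .inr (.inr (.inl rfl))
  · exact .inr (.inr (.inr rfl))

/-- An irreducible representation does not send `x` and `y` to commuting elements. -/
theorem not_commute_of_isIrrep {α : BrieskornGroup p q r b b₁ b₂ b₃ →* Sp1} (hα : IsIrrep α) :
    ¬Commute (α xG) (α yG) := by
  intro hxy
  have hhx : Commute (α hG) (α xG) := commute_hG_xG.map α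
  have hhy : Commute (α hG) (α yG) := commute_hG_yG.map α
  have hz : α zG = (α xG * α yG)⁻¹ * (α hG ^ b)⁻¹ := by
    rw [eq_inv_mul_iff_mul_eq, ← map_mul, ← map_mul, xG_mul_yG_mul_zG, map_inv, map_zpow]
  have hhz : Commute (α hG) (α zG) := by
    rw [hz]
    exact (hhx.mul_right hhy).inv_right.mul_right ((Commute.refl _).zpow_right b).inv_right
  have hxz : Commute (α xG) (α zG) := by
    rw [hz]
    exact ((Commute.refl _).mul_right hxy).inv_right.mul_right (hhx.symm.zpow_right b).inv_right
  have hyz : Commute (α yG) (α zG) := by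
    rw [hz]
    exact (hxy.symm.mul_right (Commute.refl _)).inv_right.mul_right
      (hhy.symm.zpow_right b).inv_right
  have hcomm : ∀ s ∈ α.range, ∀ t ∈ α.range, Commute s t := by
    have hr : α.range = Subgroup.closure {α xG, α yG, α zG, α hG} := by
      rw [MonoidHom.range_eq_map, ← closure_eq_top, MonoidHom.map_closure]
      simp only [Set.image_insert_eq, Set.image_singleton]
    intro s hs t ht
    rw [hr] at hs ht
    have hS : ({α xG, α yG, α zG, α hG} : Set Sp1) ⊆
        Subgroup.centralizer {α xG, α yG, α zG, α hG} := by
      intro s hs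
      rw [SetLike.mem_coe, Subgroup.mem_centralizer_iff]
      rintro t ht
      simp only [Set.mem_insert_iff, Set.mem_singleton_iff] at hs ht
      rcases hs with rfl | rfl | rfl | rfl <;> rcases ht with rfl | rfl | rfl | rfl <;>
        first | rfl | exact Commute.eq ‹_› | exact (Commute.eq ‹_›).symm
    have h1 := (Subgroup.closure_le _).mpr hS hs
    rw [← Subgroup.centralizer_closure, Subgroup.mem_centralizer_iff] at h1
    exact (h1 t ht).symm
  obtain ⟨s, t, hst⟩ := hα
  exact hst (hcomm _ ⟨s, rfl⟩ _ ⟨t, rfl⟩)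

end BrieskornGroup

/-- For an irreducible `α : G(p,q,r) → Sp(1)`: `α(h) = ±1`; none of
`α(x), α(y), α(z)` is `±1`; and there are integers `0 < ℓ₁ < p`, `0 < ℓ₂ < q`,
`0 < ℓ₃ < r` with `Re α(x) = cos(πℓ₁/p)`, `Re α(y) = cos(πℓ₂/q)`,
`Re (α(x)α(y)) = cos(πℓ₃/r)`, where `ℓ₁` is even iff `α(h)^{b₁} = 1`, `ℓ₂` is even iff
`α(h)^{b₂} = 1`, and `ℓ₃` is even iff `α(h)^{b₃ - rb} = 1`. -/
theorem stmt_5 (p q r : ℕ) (hp : 2 ≤ p) (hq : 2 ≤ q) (hr : 2 ≤ r)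
    (hpq : Nat.Coprime p q) (hqr : Nat.Coprime q r) (hpr : Nat.Coprime p r)
    (b b₁ b₂ b₃ : ℤ)
    (hsum : b₁ * q * r + b₂ * p * r + b₃ * p * q + b * p * q * r = 1)
    (α : BrieskornGroup p q r b b₁ b₂ b₃ →* Sp1) (hα : IsIrrep α) :
    (α hG = 1 ∨ α hG = -1) ∧
    (α xG ≠ 1 ∧ α xG ≠ -1) ∧ (α yG ≠ 1 ∧ α yG ≠ -1) ∧ (α zG ≠ 1 ∧ α zG ≠ -1) ∧
    ∃ ℓ₁ ℓ₂ ℓ₃ : ℤ, 0 < ℓ₁ ∧ ℓ₁ < (p : ℤ) ∧ 0 < ℓ₂ ∧ ℓ₂ < (q : ℤ) ∧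
      0 < ℓ₃ ∧ ℓ₃ < (r : ℤ) ∧
      (α xG : ℍ[ℝ]).re = Real.cos (Real.pi * ℓ₁ / p) ∧
      (α yG : ℍ[ℝ]).re = Real.cos (Real.pi * ℓ₂ / q) ∧
      ((α xG : ℍ[ℝ]) * (α yG : ℍ[ℝ])).re = Real.cos (Real.pi * ℓ₃ / r) ∧
      (Even ℓ₁ ↔ α hG ^ b₁ = 1) ∧ (Even ℓ₂ ↔ α hG ^ b₂ = 1) ∧
      (Even ℓ₃ ↔ α hG ^ (b₃ - (r : ℤ) * b) = 1) := by
  have hxy := BrieskornGroup.not_commute_of_isIrrep hα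
  have hhx : Commute (α hG) (α xG) := BrieskornGroup.commute_hG_xG.map α
  have hhy : Commute (α hG) (α yG) := BrieskornGroup.commute_hG_yG.map α
  have hh : α hG = 1 ∨ α hG = -1 := by
    by_contra hne
    refine hxy (Subtype.ext ?_)
    exact Quaternion.commute_of_commute_of_im_ne_zero
      (fun h => hne (Sp1.eq_one_or_eq_neg_one_of_im_eq_zero h))
      (congrArg Subtype.val hhx.symm.eq) (congrArg Subtype.val hhy.symm.eq)
  have hhk : ∀ k : ℤ, α hG ^ k = 1 ∨ α hG ^ k = -1 := fun k => by
    rw [Sp1.eq_one_or_eq_neg_one_iff] at hh ⊢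
    rw [← zpow_natCast, zpow_comm, zpow_natCast, hh, one_zpow]
  have hhinv : ∀ k : ℤ, (α hG ^ k)⁻¹ = 1 ∨ (α hG ^ k)⁻¹ = -1 := fun k => by
    rw [← zpow_neg]; exact hhk _
  have hx : ¬(α xG = 1 ∨ α xG = -1) := fun h =>
    hxy (Sp1.commute_of_eq_one_or_eq_neg_one h _)
  have hy : ¬(α yG = 1 ∨ α yG = -1) := fun h =>
    hxy (Sp1.commute_of_eq_one_or_eq_neg_one h _).symm
  have hm : ¬(α xG * α yG = 1 ∨ α xG * α yG = -1) := fun h => by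
    have h := (Sp1.commute_of_eq_one_or_eq_neg_one h (α xG)).eq
    rw [mul_assoc] at h
    exact hxy (mul_left_cancel h).symm
  have hxyz : α xG * α yG = (α hG ^ b)⁻¹ * (α zG)⁻¹ := by
    rw [eq_mul_inv_iff_mul_eq, ← map_mul, ← map_mul, BrieskornGroup.xG_mul_yG_mul_zG, map_inv,
      map_zpow]
  have hz : ¬(α zG = 1 ∨ α zG = -1) := fun h => by
    apply hm
    have hb := hhinv b
    rw [Sp1.eq_one_or_eq_neg_one_iff] at h hb ⊢
    have hc := Sp1.commute_of_eq_one_or_eq_neg_one (hhinv b) (α zG)⁻¹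
    rw [hxyz, hc.mul_pow, hb, inv_pow, h, inv_one, one_mul]
  have hxp : α xG ^ p = (α hG ^ b₁)⁻¹ := by
    rw [← map_pow, BrieskornGroup.xG_pow, map_inv, map_zpow]
  have hyq : α yG ^ q = (α hG ^ b₂)⁻¹ := by
    rw [← map_pow, BrieskornGroup.yG_pow, map_inv, map_zpow]
  have hmr : (α xG * α yG) ^ r = α hG ^ (b₃ - (r : ℤ) * b) := by
    have hzr : α zG ^ r = (α hG ^ b₃)⁻¹ := by
      rw [← map_pow, BrieskornGroup.zG_pow, map_inv, map_zpow]
    have hc := Sp1.commute_of_eq_one_or_eq_neg_one (hhinv b) (α zG)⁻¹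
    rw [hxyz, hc.mul_pow, inv_pow, inv_pow (α zG), hzr, inv_inv, ← zpow_natCast, ← zpow_mul,
      ← zpow_neg, ← zpow_add]
    congr 1
    ring
  obtain ⟨l₁, h1, h1', hc1, he1⟩ := Sp1.exists_re_eq_cos (n := p) (by omega) hx
    (hxp ▸ hhinv b₁)
  obtain ⟨l₂, h2, h2', hc2, he2⟩ := Sp1.exists_re_eq_cos (n := q) (by omega) hy
    (hyq ▸ hhinv b₂)
  obtain ⟨l₃, h3, h3', hc3, he3⟩ := Sp1.exists_re_eq_cos (n := r) (by omega) hm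
    (hmr ▸ hhk _)
  rw [hxp, inv_eq_one] at he1
  rw [hyq, inv_eq_one] at he2
  rw [hmr] at he3
  exact ⟨hh, not_or.mp hx, not_or.mp hy, not_or.mp hz, l₁, l₂, l₃, h1, h1', h2, h2', h3, h3',
    hc1, hc2, hc3, he1, he2, he3⟩
end
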